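/- arXiv:1605.08998 — 7 statements merged into one kernel-verified Lean document; each statement's English description precedes it below -/
import Mathlib

section
/- Let F be a field, let λ, μ be positive integers with λ dividing μ, and let t ≥ 1 be an integer. Let D be the μ × (tμ + λ) matrix over F obtained by horizontally concatenating t copies of the μ × μ identity matrix I_μ followed by the rectangular circulant matrix C_{μ×λ} (the vertical stack of μ/λ copies of I_λ). Then every μ cyclically adjacent columns of D are linearly independent: for every k ∈ ℤ/(tμ+λ)ℤ, the family of columns of D with indices k, k+1, …, k+μ−1 (taken modulo tμ+λ) is linearly independent over F. -/
/-- A matrix whose columns split into two classes is injective on columns as soon as every column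
of the first class has a row meeting no other column, and every column of the second class has
a row meeting no other column of the second class. -/
theorem linearIndependent_of_two_stage_pivots {F ι m : Type*} [Field F] [Fintype ι]
    (A : ι → m → F) (P : ι → Prop) (p : ι → m) (hne : ∀ s, A s (p s) ≠ 0)
    (hfst : ∀ s, P s → ∀ s', s' ≠ s → A s' (p s) = 0)
    (hsnd : ∀ s, ¬ P s → ∀ s', s' ≠ s → ¬ P s' → A s' (p s) = 0) :
    LinearIndependent F A := by
  rw [Fintype.linearIndependent_iff]
  intro g hg
  have hrow (i : m) : ∑ s, g s * A s i = 0 := by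
    simpa using congrFun hg i
  have hP (s : ι) (hs : P s) : g s = 0 := by
    have h := hrow (p s)
    rw [Finset.sum_eq_single s (fun s' _ h' => by rw [hfst s hs s' h', mul_zero])
      (fun h' => absurd (Finset.mem_univ s) h')] at h
    exact (mul_eq_zero.mp h).resolve_right (hne s)
  intro s
  by_cases hs : P s
  · exact hP s hs
  · have h := hrow (p s)
    rw [Finset.sum_eq_single s (fun s' _ h' => ?_)
      (fun h' => absurd (Finset.mem_univ s) h')] at h
    · exact (mul_eq_zero.mp h).resolve_right (hne s)
    · by_cases hs' : P s'
      · rw [hP s' hs', zero_mul]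
      · rw [hsnd s hs s' h' hs', mul_zero]

/-- Every residue class modulo `l` meets every interval of length `l`. -/
theorem Nat.exists_mem_interval_mod_eq {l j : ℕ} (L : ℕ) (hj : j < l) :
    ∃ x, L ≤ x ∧ x < L + l ∧ x % l = j := by
  have hl : 0 < l := by omega
  refine ⟨L + (j + l * L - L) % l, by omega, by have := Nat.mod_lt (j + l * L - L) hl; omega, ?_⟩
  have hL : L ≤ l * L := Nat.le_mul_of_pos_left L hl
  rw [Nat.add_mod_mod, show L + (j + l * L - L) = j + l * L by omega, Nat.add_mul_mod_self_left,
    Nat.mod_eq_of_lt hj]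

/-- The representative below `N` of `K + s`, for `K < N` and `s ≤ N`. -/
def cyclicShift (N K s : ℕ) : ℕ := if K + s < N then K + s else K + s - N

theorem ZMod.val_add_natCast_eq_cyclicShift {N : ℕ} (k : ZMod N) {s : ℕ} (hN : 0 < N)
    (hs : s ≤ N) : (k + (s : ZMod N)).val = cyclicShift N k.val s := by
  have : NeZero N := ⟨hN.ne'⟩
  have hk := ZMod.val_lt k
  rw [ZMod.val_add, ZMod.val_natCast, Nat.add_mod_mod, cyclicShift]
  split_ifs with h
  · exact Nat.mod_eq_of_lt h
  · rw [Nat.mod_eq_sub_mod (by omega), Nat.mod_eq_of_lt (by omega)]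

theorem Nat.mod_eq_sub_of_mem_block {T mu v : ℕ} (hT : mu ∣ T) (h1 : T ≤ v) (h2 : v < T + mu) :
    v % mu = v - T := by
  obtain ⟨c, rfl⟩ := hT
  obtain ⟨w, rfl⟩ := Nat.exists_eq_add_of_le h1
  rw [Nat.mul_add_mod, Nat.mod_eq_of_lt (by omega)]
  omega

/-- Identity columns in a common cyclic window of length `mu` are distinct unit vectors. -/
theorem cyclicShift_mod_injective {lam mu T K s s' : ℕ} (hT : mu ∣ T) (hlam : 0 < lam)
    (hK : K < T + mu + lam) (hs : s < mu) (hs' : s' < mu)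
    (hv : cyclicShift (T + mu + lam) K s < T + mu)
    (hv' : cyclicShift (T + mu + lam) K s' < T + mu)
    (h : cyclicShift (T + mu + lam) K s % mu = cyclicShift (T + mu + lam) K s' % mu) :
    s = s' := by
  unfold cyclicShift at *
  split_ifs at * with h1 h2 h2
  · have h3 : s % mu = s' % mu := Nat.ModEq.add_left_cancel' K h
    rwa [Nat.mod_eq_of_lt hs, Nat.mod_eq_of_lt hs'] at h3
  · rw [Nat.mod_eq_sub_of_mem_block hT (by omega) (by omega),
      Nat.mod_eq_of_lt (by omega : K + s' - (T + mu + lam) < mu)] at h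
    omega
  · rw [Nat.mod_eq_sub_of_mem_block (v := K + s') hT (by omega) (by omega),
      Nat.mod_eq_of_lt (by omega : K + s - (T + mu + lam) < mu)] at h
    omega
  · rw [Nat.mod_eq_of_lt (by omega), Nat.mod_eq_of_lt (by omega)] at h
    omega

/-- Every circulant column in a cyclic window of length `mu` has a row in its support that is
missed by all the identity columns of the window. -/
theorem exists_circulant_pivot {lam mu T K s : ℕ} (hT : mu ∣ T) (hdvd : lam ∣ mu)
    (hK : K < T + mu + lam) (hs : s < mu)
    (hv : T + mu ≤ cyclicShift (T + mu + lam) K s) :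
    ∃ p < mu, p % lam = cyclicShift (T + mu + lam) K s - (T + mu) ∧
      ∀ s' < mu, cyclicShift (T + mu + lam) K s' < T + mu →
        p ≠ cyclicShift (T + mu + lam) K s' % mu := by
  have hle : lam ≤ mu := Nat.le_of_dvd (by omega) hdvd
  have hsN : K + s < T + mu + lam := by
    unfold cyclicShift at hv
    split_ifs at hv <;> omega
  have hvs : cyclicShift (T + mu + lam) K s = K + s := if_pos hsN
  rw [hvs] at hv ⊢
  obtain hB | hB := le_or_gt (K + mu) (T + mu + lam)
  · refine ⟨K + s - (T + mu), by omega, Nat.mod_eq_of_lt (by omega), fun s' hs' hv' => ?_⟩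
    unfold cyclicShift at *
    rw [if_pos (by omega)] at hv' ⊢
    rw [Nat.mod_eq_sub_of_mem_block hT (by omega) (by omega)]
    omega
  obtain hC | hC := le_or_gt K (T + mu)
  · obtain ⟨p, hp1, hp2, hp3⟩ :=
      Nat.exists_mem_interval_mod_eq (K - T - lam) (by omega : K + s - (T + mu) < lam)
    refine ⟨p, by omega, hp3, fun s' hs' hv' => ?_⟩
    unfold cyclicShift at *
    split_ifs at * with h1
    · rw [Nat.mod_eq_sub_of_mem_block hT (by omega) (by omega)]
      omega
    · rw [Nat.mod_eq_of_lt (by omega)]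
      omega
  · obtain ⟨p, hp1, hp2, hp3⟩ :=
      Nat.exists_mem_interval_mod_eq (mu - lam) (by omega : K + s - (T + mu) < lam)
    have hp : p % lam = p - (mu - lam) :=
      Nat.mod_eq_sub_of_mem_block (Nat.dvd_sub hdvd dvd_rfl) hp1 hp2
    refine ⟨p, by omega, hp3, fun s' hs' hv' => ?_⟩
    unfold cyclicShift at *
    split_ifs at * with h1
    · omega
    · rw [Nat.mod_eq_of_lt (by omega)]
      omega

/-- In the matrix `D = [I_mu | ⋯ | I_mu | C_{mu×lam}]` (`t` copies of `I_mu` followed by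
the rectangular circulant matrix), every `mu` cyclically adjacent columns are linearly
independent over any field. -/
theorem identity_concat_circulant_adjacent_cols_linearIndependent
    (F : Type*) [Field F] (lam mu t : ℕ) (hlam : 0 < lam) (hmu : 0 < mu)
    (ht : 1 ≤ t) (hdvd : lam ∣ mu)
    (D : Matrix (ZMod mu) (ZMod (t * mu + lam)) F)
    (hD : ∀ (i : ZMod mu) (j : ZMod (t * mu + lam)),
      D i j = if j.val < t * mu then (if i.val = j.val % mu then 1 else 0)
              else (if i.val % lam = j.val - t * mu then 1 else 0)) :
    ∀ k : ZMod (t * mu + lam),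
      LinearIndependent F
        (fun s : Fin mu => D.transpose (k + (s.val : ZMod (t * mu + lam)))) := by
  intro k
  have : NeZero mu := ⟨hmu.ne'⟩
  have : NeZero (t * mu + lam) := ⟨by omega⟩
  obtain ⟨T, hT, hTt⟩ : ∃ T, mu ∣ T ∧ t * mu = T + mu :=
    ⟨(t - 1) * mu, dvd_mul_left _ _, by rw [← Nat.succ_mul, Nat.succ_eq_add_one,
      Nat.sub_add_cancel ht]⟩
  have hK : k.val < T + mu + lam := hTt ▸ ZMod.val_lt k
  set v : Fin mu → ℕ := fun s => cyclicShift (T + mu + lam) k.val s.val with hvdef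
  have hcol (s : Fin mu) (i : ZMod mu) :
      D.transpose (k + (s.val : ZMod (t * mu + lam))) i =
        if v s < T + mu then (if i.val = v s % mu then 1 else 0)
        else (if i.val % lam = v s - (T + mu) then 1 else 0) := by
    have hs := s.isLt
    rw [Matrix.transpose_apply, hD, ZMod.val_add_natCast_eq_cyclicShift k (by omega) (by omega)]
    simp only [hvdef, hTt]
  have hpiv (s : Fin mu) : ∃ i : ZMod mu,
      (v s < T + mu → i.val = v s % mu) ∧
      (¬ v s < T + mu → i.val % lam = v s - (T + mu) ∧
        ∀ s' : Fin mu, v s' < T + mu → i.val ≠ v s' % mu) := by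
    by_cases h : v s < T + mu
    · refine ⟨(v s : ZMod mu), fun _ => ZMod.val_natCast _ _, fun h' => absurd h h'⟩
    · obtain ⟨p, hp, hp1, hp2⟩ :=
        exists_circulant_pivot hT hdvd hK s.isLt (not_lt.mp h)
      refine ⟨(p : ZMod mu), fun h' => absurd h' h, fun _ => ?_⟩
      rw [ZMod.val_natCast_of_lt hp]
      exact ⟨hp1, fun s' => hp2 s' s'.isLt⟩
  choose p hp1 hp2 using hpiv
  refine linearIndependent_of_two_stage_pivots _ (fun s => ¬ v s < T + mu) p
    (fun s => ?_) (fun s hs s' hne => ?_) (fun s hs s' hne hs' => ?_)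
  · rw [hcol]
    by_cases h : v s < T + mu
    · simp [h, hp1 s h]
    · simp [h, (hp2 s h).1]
  · rw [hcol]
    by_cases h : v s' < T + mu
    · rw [if_pos h, if_neg ((hp2 s hs).2 s' h)]
    · rw [if_neg h, if_neg]
      rw [(hp2 s hs).1]
      intro heq
      apply hne
      have h1 := s.isLt
      have h2 := s'.isLt
      simp only [hvdef, cyclicShift] at hs h heq
      ext
      split_ifs at * <;> omega
  · rw [not_not] at hs hs'
    rw [hcol, if_pos hs', if_neg]
    rw [hp1 s hs]
    exact fun heq => hne (Fin.ext
      (cyclicShift_mod_injective hT hlam hK s.isLt s'.isLt hs hs' heq).symm)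
end

section
/- Let F be a field and let K, D be positive integers with D ≤ K−1. Let L be a K × (K−D) matrix over F with rows indexed by ℤ/Kℤ such that every K−D cyclically adjacent rows of L are linearly independent (for every k ∈ ℤ/Kℤ, the rows L_k, L_{k+1}, …, L_{k+K−D−1}, indices modulo K, are linearly independent). Then for every k ∈ ℤ/Kℤ and all message vectors x, x' ∈ F^K: if x_i = x'_i for every i ∈ {k+1, …, k+D} (indices modulo K) and x·L = x'·L, then x = x'. In particular receiver R_k can decode its wanted message x_k as well as all K−D−1 interfering messages. -/
/-- Every residue modulo `K` lies at an offset less than `K` from a given residue `a`. -/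
theorem ZMod.exists_lt_add_natCast_eq {K : ℕ} [NeZero K] (a j : ZMod K) :
    ∃ n < K, a + (n : ZMod K) = j :=
  ⟨(j - a).val, ZMod.val_lt _, by rw [ZMod.natCast_zmod_val, add_sub_cancel]⟩

/-- Distinct offsets below `m ≤ K` from a residue `a` give distinct residues modulo `K`. -/
theorem ZMod.add_natCast_fin_injective {K m : ℕ} (hm : m ≤ K) (a : ZMod K) :
    Function.Injective fun s : Fin m => a + (s.val : ZMod K) := by
  intro s t hst
  have h : (s.val : ZMod K) = (t.val : ZMod K) := add_left_cancel hst
  rw [ZMod.natCast_eq_natCast_iff] at h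
  exact Fin.ext (h.eq_of_lt_of_lt (s.2.trans_le hm) (t.2.trans_le hm))

/-- A vector on `ZMod K` whose entries vanish outside a cyclic window of linearly independent
rows of `L`, and which is annihilated by `L`, is zero. -/
theorem Matrix.eq_zero_of_vecMul_eq_zero_of_window {F ι : Type*} [Field F] {K m : ℕ} [NeZero K]
    (hm : m ≤ K) (L : Matrix (ZMod K) ι F) (a : ZMod K)
    (hL : LinearIndependent F fun s : Fin m => L (a + (s.val : ZMod K)))
    (y : ZMod K → F)
    (hy : ∀ j ∉ Set.range (fun s : Fin m => a + (s.val : ZMod K)), y j = 0)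
    (h : Matrix.vecMul y L = 0) : y = 0 := by
  have hsum : ∑ s : Fin m, y (a + (s.val : ZMod K)) • L (a + (s.val : ZMod K)) = 0 := by
    rw [← h, Matrix.vecMul_eq_sum]
    exact Fintype.sum_of_injective _ (ZMod.add_natCast_fin_injective hm a) _
      (fun j => y j • L j) (fun j hj => by simp [hy j hj]) fun _ => rfl
  have hzero := Fintype.linearIndependent_iff.mp hL _ hsum
  funext j
  by_cases hj : j ∈ Set.range fun s : Fin m => a + (s.val : ZMod K)
  · obtain ⟨s, rfl⟩ := hj
    exact hzero s
  · exact hy j hj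


/-- If every `K - D` cyclically adjacent rows of the `K × (K-D)` encoding matrix `L`
are linearly independent, then each receiver `R_k`, knowing `x_{k+1},…,x_{k+D}`, can
recover the whole message vector (its wanted message and all interfering messages)
from the codeword `x ᵥ* L`. -/
theorem adjacent_rows_linearIndependent_implies_full_decoding
    (F : Type*) [Field F] (K D : ℕ) [NeZero K] (hD : 1 ≤ D) (hDK : D ≤ K - 1)
    (L : Matrix (ZMod K) (Fin (K - D)) F)
    (hLI : ∀ k : ZMod K,
      LinearIndependent F (fun s : Fin (K - D) => L (k + (s.val : ZMod K)))) :
    ∀ k : ZMod K, ∀ x x' : ZMod K → F,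
      (∀ i : Fin D, x (k + 1 + (i.val : ZMod K)) = x' (k + 1 + (i.val : ZMod K))) →
      Matrix.vecMul x L = Matrix.vecMul x' L → x = x' := by
  intro k x x' hx hL
  refine sub_eq_zero.mp (Matrix.eq_zero_of_vecMul_eq_zero_of_window (Nat.sub_le K D) L
    (k + 1 + (D : ZMod K)) (hLI _) (x - x') (fun j hj => ?_) ?_)
  · obtain ⟨n, hn, rfl⟩ := ZMod.exists_lt_add_natCast_eq (k + 1) j
    rcases lt_or_ge n D with hnD | hnD
    · exact sub_eq_zero.mpr (hx ⟨n, hnD⟩)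
    · refine absurd ⟨⟨n - D, by omega⟩, ?_⟩ hj
      simp [Nat.cast_sub hnD]
  · rw [Matrix.sub_vecMul, hL, sub_self]
end

section
/- Let F be a field, let m ≥ n ≥ 1 and t ≥ 1 be integers, and let D be an m × n matrix over F such that (i) the top n × n submatrix of D (rows 1,…,n) is the identity matrix I_n, and (ii) every n cyclically adjacent rows of D are linearly independent (for every k ∈ ℤ/mℤ, rows D_k, D_{k+1}, …, D_{k+n−1}, indices modulo m, are linearly independent). Let M = [I_m | I_m | ⋯ | I_m | D] be the m × (tm + n) matrix obtained by horizontally concatenating t copies of the m × m identity matrix followed by D. Then every m cyclically adjacent columns of M are linearly independent: for every k ∈ ℤ/(tm+n)ℤ, the columns of M with indices k, k+1, …, k+m−1 (taken modulo tm+n) are linearly independent over F. -/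
/-- A vector orthogonal to `n` linearly independent vectors of an `n`-dimensional coordinate
space is zero. -/
theorem eq_zero_of_forall_dotProduct_eq_zero {F ι κ : Type*} [Field F] [Fintype ι] [Fintype κ]
    (hcard : Fintype.card ι = Fintype.card κ) {v : ι → κ → F} (hv : LinearIndependent F v)
    {y : κ → F} (hy : ∀ i, v i ⬝ᵥ y = 0) : y = 0 := by
  classical
  have hspan := hv.span_eq_top_of_card_eq_finrank' (by simpa using hcard)
  have hzero : (dotProductBilin F F).flip y = 0 :=
    LinearMap.ext_on_range hspan fun i => by simpa [dotProductBilin] using hy i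
  funext j
  have hj := LinearMap.congr_fun hzero (Pi.single j 1)
  simpa [dotProductBilin] using hj

/-- The residue of the `s`-th index of a cyclic window starting at `k`. -/
theorem ZMod.val_add_natCast_eq_ite {N : ℕ} [NeZero N] (k : ZMod N) {s : ℕ} (hs : s < N) :
    (k + (s : ZMod N)).val = if k.val + s < N then k.val + s else k.val + s - N := by
  have hk := k.val_lt
  rw [ZMod.val_add, ZMod.val_natCast, Nat.mod_eq_of_lt hs]
  split_ifs with h
  · exact Nat.mod_eq_of_lt h
  · rw [Nat.mod_eq_sub_mod (by omega), Nat.mod_eq_of_lt (by omega)]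

/-- Two indices in the identity blocks of a cyclic window of length `m` that are congruent
modulo `m` coincide. -/
theorem eq_of_mod_eq_of_cyclic_window {m n t k s s' c c' : ℕ} (hk : k < t * m + n)
    (hs : s < m) (hs' : s' < m)
    (hc : c = if k + s < t * m + n then k + s else k + s - (t * m + n))
    (hc' : c' = if k + s' < t * m + n then k + s' else k + s' - (t * m + n))
    (hct : c < t * m) (hct' : c' < t * m) (hmod : c % m = c' % m) : s = s' := by
  have key : ∀ a b : ℕ, a < m → b < m → (k + a) % m = (k + b) % m → a = b := by
    intro a b ha hb h
    have h' : a ≡ b [MOD m] := Nat.ModEq.add_left_cancel' k h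
    rwa [Nat.ModEq, Nat.mod_eq_of_lt ha, Nat.mod_eq_of_lt hb] at h'
  have key' : ∀ a b : ℕ, a < m → b < m → k + a < t * m → t * m + n ≤ k + b →
      (k + a) % m ≠ (k + b - (t * m + n)) % m := by
    intro a b ha hb hat hbt h
    have ht : t ≠ 0 := by rintro rfl; omega
    obtain ⟨u, hu⟩ := Nat.exists_eq_succ_of_ne_zero ht
    have hum : t * m = u * m + m := by rw [hu, Nat.succ_mul]
    rw [Nat.mod_eq_of_lt (show k + b - (t * m + n) < m by omega),
      show k + a = (k + a - u * m) + u * m by omega, Nat.add_mul_mod_self_right,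
      Nat.mod_eq_of_lt (by omega)] at h
    omega
  split_ifs at hc hc' with h h'
  · subst hc hc'
    exact key _ _ hs hs' hmod
  · subst hc hc'
    exact absurd hmod (key' _ _ hs hs' hct (by omega))
  · subst hc hc'
    exact absurd hmod.symm (key' _ _ hs' hs hct' (by omega))
  · subst hc hc'
    rw [Nat.mod_eq_of_lt (by omega), Nat.mod_eq_of_lt (by omega)] at hmod
    omega

/-- For a cyclic window of `m` columns of `[I_m | ⋯ | I_m | D]` there are `n` cyclically adjacent
rows each of which meets no pivot of an identity block in the window, or is one of the first `n`
rows and its pivot column in `D` lies outside the window. -/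
theorem exists_cyclic_rows_of_cyclic_window {m n t k : ℕ} (hn : 0 < n) (hnm : n ≤ m) (ht : 1 ≤ t)
    (hk : k < t * m + n) (col : Fin m → ℕ)
    (hcol : ∀ s, col s = if k + s.val < t * m + n then k + s.val
      else k + s.val - (t * m + n)) :
    ∃ r : ℕ, ∀ i < n, (∀ s, col s < t * m → (r + i) % m ≠ col s % m) ∨
      ((r + i) % m < n ∧ ∀ s, col s ≠ t * m + (r + i) % m) := by
  obtain ⟨u, hu⟩ := Nat.exists_eq_add_of_le' ht
  have hum : t * m = u * m + m := by rw [hu, Nat.succ_mul]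
  have hpivot : ∀ s, col s < t * m → k ≤ col s → u * m ≤ k →
      col s % m = col s - u * m := by
    intro s h1 h2 h3
    conv_lhs => rw [show col s = (col s - u * m) + u * m by omega]
    rw [Nat.add_mul_mod_self_right, Nat.mod_eq_of_lt (by omega)]
  rcases le_or_gt (k + m) (u * m + m + n) with h1 | h1
  · refine ⟨0, fun i hi => ?_⟩
    rw [zero_add, Nat.mod_eq_of_lt (hi.trans_le hnm)]
    by_cases hb : u * m + m + i < k + m
    · left
      intro s hs
      have := hcol s
      have hs' := s.isLt
      rw [if_pos (by omega)] at this
      rw [hpivot s hs (by omega) (by omega)]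
      omega
    · right
      refine ⟨hi, fun s => ?_⟩
      have := hcol s
      have hs' := s.isLt
      split_ifs at this <;> omega
  · rcases le_or_gt k (u * m + m) with h2 | h2
    · refine ⟨k - u * m - n, fun i hi => Or.inl fun s hs => ?_⟩
      have := hcol s
      have hs' := s.isLt
      rw [Nat.mod_eq_of_lt (by omega)]
      split_ifs at this with h3
      · rw [hpivot s hs (by omega) (by omega)]
        omega
      · rw [Nat.mod_eq_of_lt (a := col s) (by omega)]
        omega
    · refine ⟨k - u * m - n, fun i hi => ?_⟩
      by_cases hb : k - u * m - n + i < m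
      · left
        intro s hs
        have := hcol s
        have hs' := s.isLt
        rw [Nat.mod_eq_of_lt hb]
        split_ifs at this with h3
        · omega
        · rw [Nat.mod_eq_of_lt (by omega)]
          omega
      · right
        have hmod : (k - u * m - n + i) % m = k - u * m - n + i - m := by
          rw [Nat.mod_eq_sub_mod (by omega), Nat.mod_eq_of_lt (by omega)]
        rw [hmod]
        refine ⟨by omega, fun s => ?_⟩
        have := hcol s
        have hs' := s.isLt
        split_ifs at this <;> omega


/-- Induction step of the CONSTRUCTION (column version): if `D` is an `m × n` matrix
whose top `n × n` block is the identity and whose every `n` cyclically adjacent rows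
are linearly independent, then in the matrix `M = [I_m | ⋯ | I_m | D]` (`t` copies of
`I_m` followed by `D`) every `m` cyclically adjacent columns are linearly independent. -/
theorem construction_step_adjacent_cols_linearIndependent
    (F : Type*) [Field F] (m n t : ℕ) (hn : 0 < n) (hnm : n ≤ m) (ht : 1 ≤ t)
    (D : Matrix (ZMod m) (ZMod n) F)
    (htop : ∀ i j : ZMod n, D ((i.val : ZMod m)) j = if i = j then 1 else 0)
    (hrows : ∀ k : ZMod m,
      LinearIndependent F (fun s : Fin n => D (k + (s.val : ZMod m))))
    (M : Matrix (ZMod m) (ZMod (t * m + n)) F)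
    (hM1 : ∀ (i : ZMod m) (j : ZMod (t * m + n)), j.val < t * m →
      M i j = if i.val = j.val % m then 1 else 0)
    (hM2 : ∀ (i : ZMod m) (j : ZMod (t * m + n)), t * m ≤ j.val →
      M i j = D i ((j.val - t * m : ℕ) : ZMod n)) :
    ∀ k : ZMod (t * m + n),
      LinearIndependent F
        (fun s : Fin m => M.transpose (k + (s.val : ZMod (t * m + n)))) := by
  classical
  have hm : 0 < m := hn.trans_le hnm
  have : NeZero m := ⟨hm.ne'⟩
  have : NeZero n := ⟨hn.ne'⟩
  have : NeZero (t * m + n) := ⟨by omega⟩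
  have htm : m ≤ t * m := Nat.le_mul_of_pos_left m ht
  intro k
  rw [Fintype.linearIndependent_iff]
  intro g hg
  let col : Fin m → ℕ := fun s => (k + (s.val : ZMod (t * m + n))).val
  have hcol : ∀ s : Fin m, col s = if k.val + s.val < t * m + n then k.val + s.val
      else k.val + s.val - (t * m + n) := fun s => k.val_add_natCast_eq_ite (by omega)
  have hlt : ∀ s, col s < t * m + n := fun s => ZMod.val_lt _
  let y : ZMod n → F := fun j => ∑ s, if col s = t * m + j.val then g s else 0
  have hD : ∀ i j, M i j = if j.val < t * m then (if i.val = j.val % m then 1 else 0)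
      else ∑ l : ZMod n, if j.val = t * m + l.val then D i l else 0 := by
    intro i j
    split_ifs with h
    · simp [hM1 i j h, *]
    · simp [hM1 i j h, *]
    · rw [hM2 i j (not_lt.1 h)]
      have hj := j.val_lt
      have heq : ∀ l : ZMod n, j.val = t * m + l.val ↔ ((j.val - t * m : ℕ) : ZMod n) = l := by
        intro l
        have hl : ((j.val - t * m : ℕ) : ZMod n).val = j.val - t * m :=
          ZMod.val_cast_of_lt (by omega)
        rw [← (ZMod.val_injective n).eq_iff, hl]
        omega
      simp [heq]
  have hrow : ∀ i : ZMod m,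
      (∑ s, if col s < t * m ∧ i.val = col s % m then g s else 0) + D i ⬝ᵥ y = 0 := by
    intro i
    have hi := congrFun hg i
    simp only [Finset.sum_apply, Pi.smul_apply, Matrix.transpose_apply, smul_eq_mul,
      Pi.zero_apply] at hi
    refine Eq.trans ?_ hi
    have hy : D i ⬝ᵥ y = ∑ s, ∑ l : ZMod n, if col s = t * m + l.val then g s * D i l else 0 := by
      simp only [dotProduct, y, Finset.mul_sum, mul_ite, mul_zero]
      rw [Finset.sum_comm]
      simp only [mul_comm]
    rw [hy, ← Finset.sum_add_distrib]
    refine Finset.sum_congr rfl fun s _ => ?_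
    rw [hD]
    change _ = g s * (if col s < t * m then (if i.val = col s % m then 1 else 0)
      else ∑ l : ZMod n, if col s = t * m + l.val then D i l else 0)
    by_cases h : col s < t * m
    · have hne : ∀ l : ZMod n, col s ≠ t * m + l.val := fun l => by omega
      simp [h, hne]
    · simp [h, Finset.mul_sum]
  have hy : y = 0 := by
    obtain ⟨r, hr⟩ := exists_cyclic_rows_of_cyclic_window hn hnm ht k.val_lt col hcol
    refine eq_zero_of_forall_dotProduct_eq_zero (by simp) (hrows (r : ZMod m)) fun i => ?_
    have hval : ((r : ZMod m) + (i.val : ZMod m)).val = (r + i.val) % m := by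
      rw [← Nat.cast_add, ZMod.val_natCast]
    rcases hr i i.isLt with h | ⟨h, h'⟩
    · have hi := hrow ((r : ZMod m) + (i.val : ZMod m))
      rw [hval, Finset.sum_eq_zero fun s _ => if_neg fun hs => h s hs.1 hs.2, zero_add] at hi
      exact hi
    · have hl : (((r + i.val) % m : ℕ) : ZMod n).val = (r + i.val) % m := ZMod.val_cast_of_lt h
      have hDi : D ((r : ZMod m) + (i.val : ZMod m)) =
          Pi.single (((r + i.val) % m : ℕ) : ZMod n) 1 := by
        funext j
        rw [← Nat.cast_add, ← ZMod.natCast_mod, ← hl, htop, hl, Pi.single_apply]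
        simp only [eq_comm]
      rw [hDi, single_one_dotProduct]
      refine Finset.sum_eq_zero fun s _ => if_neg ?_
      rw [hl]
      exact h' s
  intro s
  by_cases hs : col s < t * m
  · have hi := hrow ((col s : ℕ) : ZMod m)
    rw [hy, dotProduct_zero, add_zero, Finset.sum_eq_single s, ZMod.val_natCast,
      if_pos ⟨hs, rfl⟩] at hi
    · exact hi
    · intro s' _ hne
      rw [ZMod.val_natCast]
      exact if_neg fun h => hne <| Fin.ext <| eq_of_mod_eq_of_cyclic_window k.val_lt
        s'.isLt s.isLt (hcol s') (hcol s) h.1 hs h.2.symm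
    · simp
  · have hl : ((col s - t * m : ℕ) : ZMod n).val = col s - t * m :=
      ZMod.val_cast_of_lt (by have := hlt s; omega)
    have hi : y ((col s - t * m : ℕ) : ZMod n) = 0 := congrFun hy _
    simp only [y, hl] at hi
    rw [Finset.sum_eq_single s, if_pos (by omega)] at hi
    · exact hi
    · intro s' _ hne
      refine if_neg fun h => hne <| Fin.ext ?_
      have h1 := hcol s
      have h2 := hcol s'
      split_ifs at h1 h2 <;> omega
    · simp
end

section
/- For all integers K and D with K > D ≥ 1, there exists a K × (K−D) matrix M over ℤ all of whose entries are 0 or 1, such that for every field F the following holds: letting M_F denote the image of M under the canonical ring homomorphism ℤ → F applied entrywise, every K−D cyclically adjacent rows of M_F are linearly independent over F, i.e. for every k ∈ ℤ/Kℤ the rows of M_F with indices k, k+1, …, k+K−D−1 (taken modulo K) are linearly independent. -/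
/-- `R`, read as a `d × n` matrix, is such that no nonzero word `(x, R x)` over `F` vanishes
on a window of `n` cyclically consecutive positions (starting at `k`) out of `n + d`. -/
def CyclicWindowsFaithful (F : Type) [Field F] (n d : ℕ) (R : ℕ → ℕ → ℤ) : Prop :=
  ∀ (k : ℕ) (x : ℕ → F),
    (∀ j < n, k ≤ j ∨ j + d < k → x j = 0) →
    (∀ j < d, k ≤ n + j → j < k → ∑ i ∈ Finset.range n, (R j i : F) * x i = 0) →
    ∀ j < n, x j = 0

/-- Faithfulness is preserved by stacking an identity block on top of `R`. -/
theorem CyclicWindowsFaithful.prepend_rows {F : Type} [Field F] {n d : ℕ} {R : ℕ → ℕ → ℤ}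
    (h : CyclicWindowsFaithful F n d R) :
    CyclicWindowsFaithful F n (d + n)
      (fun j i => if j < n then (if i = j then 1 else 0) else R (j - n) i) := by
  intro k x hx hy
  have hxy : ∀ j < n, k ≤ n + j → j < k → x j = 0 := by
    intro j hj h₁ h₂
    simpa [hj] using hy j (by omega) h₁ h₂
  refine h (k - n) x (fun j hj hk => ?_) (fun j hj h₁ h₂ => ?_)
  · by_cases hc : k ≤ j ∨ j + (d + n) < k
    · exact hx j hj hc
    · exact hxy j hj (by omega) (by omega)
  · simpa using hy (j + n) (by omega) (by omega) (by omega)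

/-- Faithfulness is preserved by placing an identity block to the left of `R`. -/
theorem CyclicWindowsFaithful.prepend_cols {F : Type} [Field F] {n d : ℕ} {R : ℕ → ℕ → ℤ}
    (h : CyclicWindowsFaithful F n d R) :
    CyclicWindowsFaithful F (d + n) d
      (fun j i => if i < d then (if i = j then 1 else 0) else R j (i - d)) := by
  intro k x hx hy
  have hsum : ∀ j < d, k ≤ d + n + j → j < k →
      x j + ∑ i ∈ Finset.range n, (R j i : F) * x (d + i) = 0 := by
    intro j hj h₁ h₂
    have h₃ := hy j hj h₁ h₂
    rw [Finset.sum_range_add] at h₃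
    rw [← h₃]
    congr 1
    · rw [Finset.sum_eq_single_of_mem j (by simpa using hj)]
      · simp [hj]
      · intro i hi hij
        simp [Finset.mem_range.mp hi, hij]
    · simp
  have htail : ∀ j < n, x (d + j) = 0 := by
    refine h (k - d) (fun j => x (d + j)) (fun j hj hk => ?_) (fun j hj h₁ h₂ => ?_)
    · exact hx (d + j) (by omega) (by omega)
    · have h₃ := hsum j hj (by omega) (by omega)
      rwa [hx j (by omega) (by omega), zero_add] at h₃
  intro j hj
  by_cases hjd : j < d
  · by_cases hc : k ≤ j ∨ j + d < k
    · exact hx j hj hc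
    · have h₃ := hsum j hjd (by omega) (by omega)
      rwa [Finset.sum_eq_zero fun i hi => by rw [htail i (Finset.mem_range.mp hi), mul_zero],
        add_zero] at h₃
  · simpa [Nat.add_sub_cancel' (not_lt.mp hjd)] using htail (j - d) (by omega)

/-- A binary matrix of any shape whose cyclic windows are faithful over every field, built
along the Euclidean algorithm. -/
theorem exists_binary_cyclicWindowsFaithful (n d : ℕ) :
    ∃ R : ℕ → ℕ → ℤ, (∀ i j, R i j = 0 ∨ R i j = 1) ∧
      ∀ (F : Type) [Field F], CyclicWindowsFaithful F n d R := by
  induction hm : n + d using Nat.strong_induction_on generalizing n d with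
  | _ m ih =>
    rcases Nat.eq_zero_or_pos n with rfl | hn
    · exact ⟨0, by simp, fun F _ k x _ _ j hj => absurd hj (Nat.not_lt_zero j)⟩
    rcases Nat.eq_zero_or_pos d with rfl | hd
    · exact ⟨0, by simp, fun F _ k x hx _ j hj => hx j hj (by omega)⟩
    rcases le_total n d with hnd | hnd
    · obtain ⟨R, hR, hF⟩ := ih (n + (d - n)) (by omega) n (d - n) rfl
      obtain ⟨d, rfl⟩ := Nat.exists_eq_add_of_le' hnd
      rw [Nat.add_sub_cancel] at hF
      refine ⟨_, fun i j => ?_, fun F _ => (hF F).prepend_rows⟩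
      split_ifs <;> simp [hR]
    · obtain ⟨R, hR, hF⟩ := ih (n - d + d) (by omega) (n - d) d rfl
      obtain ⟨n, rfl⟩ := Nat.exists_eq_add_of_le hnd
      rw [Nat.add_sub_cancel_left] at hF
      refine ⟨_, fun i j => ?_, fun F _ => (hF F).prepend_cols⟩
      split_ifs <;> simp [hR]

/-- For every `K > D ≥ 1` there is a `K × (K-D)` binary (0–1) integer matrix such
that, over every field `F`, every `K - D` cyclically adjacent rows of its image in
`F` are linearly independent. -/
theorem exists_binary_matrix_adjacent_rows_linearIndependent_over_every_field
    (K D : ℕ) (hD : 1 ≤ D) (hDK : D < K) :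
    ∃ M : Matrix (ZMod K) (Fin (K - D)) ℤ,
      (∀ i j, M i j = 0 ∨ M i j = 1) ∧
      ∀ (F : Type) [Field F], ∀ k : ZMod K,
        LinearIndependent F
          (fun s : Fin (K - D) => fun j => ((M (k + (s.val : ZMod K)) j : ℤ) : F)) := by
  obtain ⟨R, hR, hF⟩ := exists_binary_cyclicWindowsFaithful (K - D) D
  have : NeZero K := ⟨by omega⟩
  refine ⟨fun i j => if i.val < K - D then (if j.val = i.val then 1 else 0)
    else R (i.val - (K - D)) j, fun i j => ?_, fun F _ k => ?_⟩
  · dsimp only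
    split_ifs <;> simp [hR]
  let A : Matrix (Fin (K - D)) (Fin (K - D)) F := fun s j =>
    (((if (k + (s.val : ZMod K)).val < K - D then
        (if j.val = (k + (s.val : ZMod K)).val then 1 else 0)
      else R ((k + (s.val : ZMod K)).val - (K - D)) j : ℤ)) : F)
  change LinearIndependent F A.row
  rw [Matrix.linearIndependent_rows_iff_isUnit, ← Matrix.mulVec_injective_iff_isUnit,
    ← Matrix.coe_mulVecLin, ← LinearMap.ker_eq_bot, LinearMap.ker_eq_bot']
  intro v hv
  have hk := k.val_lt
  have hval : ∀ s t : ℕ, s < K - D → t < K → (k.val + s = t ∨ k.val + s = t + K) →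
      (k + (s : ZMod K)).val = t := by
    intro s t hs ht h
    rw [ZMod.val_add, ZMod.val_natCast, Nat.add_mod_mod]
    rcases h with h | h <;> rw [h]
    · exact Nat.mod_eq_of_lt ht
    · rw [Nat.add_mod_right, Nat.mod_eq_of_lt ht]
  have hrow : ∀ s (hs : s < K - D), ∑ j, A ⟨s, hs⟩ j * v j = 0 := fun s hs =>
    congrFun hv ⟨s, hs⟩
  have hx := hF F k.val (fun j => if h : j < K - D then v ⟨j, h⟩ else 0) ?_ ?_
  · ext j
    simpa using hx j j.isLt
  · intro j hj hc
    obtain ⟨s, hs, hsj⟩ : ∃ s, s < K - D ∧ (k.val + s = j ∨ k.val + s = j + K) := by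
      rcases hc with hc | hc
      · exact ⟨j - k.val, by omega, by omega⟩
      · exact ⟨j + K - k.val, by omega, by omega⟩
    have h := hrow s hs
    simp only [A, hval s j hs (by omega) hsj, hj, if_true] at h
    rw [Finset.sum_eq_single_of_mem ⟨j, hj⟩ (Finset.mem_univ _)] at h
    · simpa [hj] using h
    · intro i _ hij
      simp [Fin.ext_iff.not.mp hij]
  · intro j hj h₁ h₂
    have h := hrow (K - D + j - k.val) (by omega)
    simp only [A, hval (K - D + j - k.val) (K - D + j) (by omega) (by omega) (by omega)] at h
    rw [Finset.sum_range]
    simpa using h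
end

section
/- For all integers K and D with K > D ≥ 1 and every field F, there exists a K × (K−D) matrix L over F (an optimal-length scalar linear index code for the symmetric one-sided neighboring antidote problem) such that for every k ∈ ℤ/Kℤ and all message vectors x, x' ∈ F^K: if x_i = x'_i for every i ∈ {k+1, k+2, …, k+D} (indices modulo K) and x·L = x'·L, then x_k = x'_k. In particular, K−D transmitted symbols suffice for every receiver R_k to decode its wanted message x_k from the codeword x·L and its side information. -/
/-- The coordinates of `Fin K` lying in the cyclic window of length `d` starting at `a`. -/
def cyclicWindow (K d a : ℕ) : Set (Fin K) :=
  {j | (a ≤ j.val ∧ j.val < a + d) ∨ j.val + K < a + d}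

/-- No nonzero vector in the kernel of `L` vanishes on a cyclic window of length `d`. -/
def KernelAvoidsWindows {F : Type*} [Field F] {K n : ℕ} (d : ℕ)
    (L : (Fin K → F) →ₗ[F] (Fin n → F)) : Prop :=
  ∀ a ≤ K, ∀ y : Fin K → F, L y = 0 → (∀ j ∈ cyclicWindow K d a, y j = 0) → y = 0

/-- Appending to each vector a copy of its first `d` coordinates lengthens the code by `d`. -/
theorem KernelAvoidsWindows.exists_repeat {F : Type*} [Field F] {K n d : ℕ} (hK : K = n + d)
    {L : (Fin K → F) →ₗ[F] (Fin n → F)} (hL : KernelAvoidsWindows d L) :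
    ∃ L' : (Fin (K + d) → F) →ₗ[F] (Fin (n + d) → F), KernelAvoidsWindows d L' := by
  let r : (Fin (K + d) → F) →ₗ[F] (Fin K → F) := LinearMap.funLeft F F (Fin.castAdd d)
  let p : Fin (K + d) → (Fin (K + d) → F) →ₗ[F] F := LinearMap.proj
  let L' : (Fin (K + d) → F) →ₗ[F] (Fin (n + d) → F) := LinearMap.pi fun j =>
    Fin.addCases (motive := fun _ => (Fin (K + d) → F) →ₗ[F] F)
      (fun i => LinearMap.proj i ∘ₗ L ∘ₗ r)
      (fun i => p (Fin.natAdd K i) -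
        p (Fin.castAdd d (Fin.castLE (show d ≤ K by omega) i))) j
  refine ⟨L', fun a ha y hy hw => ?_⟩
  have hLr : L (r y) = 0 := by
    funext i
    simpa [L'] using congrFun hy (Fin.castAdd d i)
  have hrep : ∀ i (hi : i < d), y ⟨K + i, by omega⟩ = y ⟨i, by omega⟩ := by
    intro i hi
    have h := congrFun hy (Fin.natAdd n ⟨i, hi⟩)
    simp only [L', p, LinearMap.pi_apply, Fin.addCases_right, LinearMap.sub_apply,
      LinearMap.proj_apply, Pi.zero_apply, sub_eq_zero] at h
    exact h
  have hr : r y = 0 := by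
    by_cases haK : a < K
    · refine hL a haK.le _ hLr fun j hj => ?_
      change y ⟨j, by omega⟩ = 0
      have hj' : (a ≤ j.val ∧ j.val < a + d) ∨ j.val + K < a + d := hj
      rcases hj' with hj' | hj'
      · exact hw _ (Or.inl hj')
      · rw [← hrep j (by omega)]
        exact hw _ (Or.inl (by dsimp only; omega))
    · refine hL 0 (Nat.zero_le _) _ hLr fun j hj => ?_
      change y ⟨j, by omega⟩ = 0
      have hj' : (0 ≤ j.val ∧ j.val < 0 + d) ∨ j.val + K < 0 + d := hj
      by_cases hja : K + j.val < a
      · exact hw _ (Or.inr (by dsimp only; omega))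
      · rw [← hrep j (by omega)]
        exact hw _ (Or.inl (by dsimp only; omega))
  have hlow : ∀ i (hi : i < K), y ⟨i, by omega⟩ = 0 := fun i hi => congrFun hr ⟨i, hi⟩
  funext ⟨j, hj⟩
  by_cases hjK : j < K
  · exact hlow j hjK
  · obtain ⟨i, rfl⟩ := Nat.exists_eq_add_of_le (not_lt.mp hjK)
    exact (hrep i (by omega)).trans (hlow i (by omega))

/-- Adding the last `n` coordinates onto the first `n` lengthens the window by `n`. -/
theorem KernelAvoidsWindows.exists_fold {F : Type*} [Field F] {K n d : ℕ} (hK : K = n + d)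
    {L : (Fin K → F) →ₗ[F] (Fin n → F)} (hL : KernelAvoidsWindows d L) :
    ∃ L' : (Fin (K + n) → F) →ₗ[F] (Fin n → F), KernelAvoidsWindows K L' := by
  let f : (Fin (K + n) → F) →ₗ[F] (Fin K → F) := LinearMap.pi fun j =>
    LinearMap.proj (Fin.castAdd n j) +
      if h : j.val < n then LinearMap.proj (Fin.natAdd K ⟨j.val, h⟩) else 0
  refine ⟨L ∘ₗ f, fun a ha y hy hw => ?_⟩
  have hvan : ∀ i (hi : i < K + n), (a ≤ i ∧ i < a + K) ∨ i + n < a → y ⟨i, hi⟩ = 0 :=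
    fun i hi h => hw _ (h.imp id fun h => by dsimp only; omega)
  have hf₁ : ∀ i (hi : i < n), f y ⟨i, by omega⟩ = y ⟨i, by omega⟩ + y ⟨K + i, by omega⟩ := by
    intro i hi
    simp [f, hi, Fin.castAdd, Fin.castLE, Fin.natAdd]
  have hf₂ : ∀ i (hi : i < K), n ≤ i → f y ⟨i, hi⟩ = y ⟨i, by omega⟩ := by
    intro i hi hni
    simp [f, not_lt.mpr hni, Fin.castAdd, Fin.castLE]
  obtain ⟨b, hb, hbw⟩ : ∃ b ≤ K, ∀ j ∈ cyclicWindow K d b, f y j = 0 := by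
    refine ⟨if a ≤ n then n else if a ≤ K then a else a - K, by split_ifs <;> omega, ?_⟩
    rintro ⟨j, hjK⟩ hj
    simp only [cyclicWindow, Set.mem_ofPred_eq] at hj
    by_cases hjn : j < n
    · rw [hf₁ j hjn, hvan j (by omega) (by split_ifs at hj <;> omega),
        hvan (K + j) (by omega) (by split_ifs at hj <;> omega), add_zero]
    · rw [hf₂ j hjK (by omega)]
      exact hvan j (by omega) (by split_ifs at hj <;> omega)
  have hfy : f y = 0 := hL b hb _ hy hbw
  have hpair : ∀ i (hi : i < n), y ⟨i, by omega⟩ = 0 ∧ y ⟨K + i, by omega⟩ = 0 := by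
    intro i hi
    have h := hf₁ i hi
    rw [hfy, Pi.zero_apply] at h
    by_cases hia : (a ≤ i ∧ i < a + K) ∨ i + n < a
    · have h0 := hvan i (by omega) hia
      rw [h0, zero_add] at h
      exact ⟨h0, h.symm⟩
    · have h0 := hvan (K + i) (by omega) (by omega)
      rw [h0, add_zero] at h
      exact ⟨h.symm, h0⟩
  funext ⟨j, hj⟩
  by_cases hjn : j < n
  · exact (hpair j hjn).1
  by_cases hjK : j < K
  · rw [← hf₂ j hjK (by omega), hfy]
    rfl
  · obtain ⟨i, rfl⟩ := Nat.exists_eq_add_of_le (not_lt.mp hjK)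
    exact (hpair i (by omega)).2

/-- Codes whose kernel avoids cyclic windows exist for all parameters, by Euclid's algorithm. -/
theorem exists_kernelAvoidsWindows (F : Type*) [Field F] (n d : ℕ) :
    ∃ L : (Fin (n + d) → F) →ₗ[F] (Fin n → F), KernelAvoidsWindows d L := by
  induction hN : n + d using Nat.strong_induction_on generalizing n d with
  | _ N ih =>
    subst hN
    rcases Nat.eq_zero_or_pos n with rfl | hn
    · refine ⟨0, fun a ha y _ hw => funext fun j => hw j ?_⟩
      simp only [cyclicWindow, Set.mem_ofPred_eq]
      omega
    rcases Nat.eq_zero_or_pos d with rfl | hd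
    · exact ⟨LinearMap.id, fun a _ y hy _ => hy⟩
    rcases le_total d n with h | h
    · obtain ⟨m, rfl⟩ := Nat.exists_eq_add_of_le' h
      obtain ⟨L, hL⟩ := ih (m + d) (by omega) m d rfl
      exact hL.exists_repeat rfl
    · obtain ⟨m, rfl⟩ := Nat.exists_eq_add_of_le h
      obtain ⟨L, hL⟩ := ih (n + m) (by omega) n m rfl
      rw [Nat.add_comm n (n + m)]
      exact hL.exists_fold rfl


/-- Over every field `F` and for all `K > D ≥ 1` there exists an optimal-length
(`K × (K-D)`) scalar linear index code for the symmetric one-sided neighboring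
antidote problem: every receiver `R_k`, knowing `x_{k+1},…,x_{k+D}`, can decode its
wanted message `x_k` from the codeword `x ᵥ* L`. -/
theorem exists_optimal_scalar_linear_index_code
    (F : Type*) [Field F] (K D : ℕ) [NeZero K] (hD : 1 ≤ D) (hDK : D < K) :
    ∃ L : Matrix (ZMod K) (Fin (K - D)) F,
      ∀ k : ZMod K, ∀ x x' : ZMod K → F,
        (∀ i : Fin D, x (k + 1 + (i.val : ZMod K)) = x' (k + 1 + (i.val : ZMod K))) →
        Matrix.vecMul x L = Matrix.vecMul x' L → x k = x' k := by
  obtain ⟨L, hL⟩ : ∃ L : (Fin K → F) →ₗ[F] (Fin (K - D) → F), KernelAvoidsWindows D L := by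
    have h := exists_kernelAvoidsWindows F (K - D) D
    rwa [Nat.sub_add_cancel hDK.le] at h
  let g : (ZMod K → F) →ₗ[F] (Fin K → F) := LinearMap.funLeft F F fun j => (j.val : ZMod K)
  refine ⟨(LinearMap.toMatrix' (L ∘ₗ g)).transpose, fun k x x' hx hxL => ?_⟩
  rw [Matrix.vecMul_transpose, Matrix.vecMul_transpose, LinearMap.toMatrix'_mulVec,
    LinearMap.toMatrix'_mulVec, ← sub_eq_zero, ← map_sub] at hxL
  have ha : (((k + 1).val : ℕ) : ZMod K) = k + 1 := ZMod.natCast_zmod_val _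
  have haK : (k + 1).val < K := ZMod.val_lt _
  have hzero : g (x - x') = 0 := by
    refine hL (k + 1).val haK.le _ hxL fun j hj => ?_
    have hcast : ∃ i : Fin D, (j.val : ZMod K) = k + 1 + (i.val : ZMod K) := by
      rcases hj with ⟨h₁, h₂⟩ | h
      · refine ⟨⟨j.val - (k + 1).val, by omega⟩, ?_⟩
        rw [Nat.cast_sub h₁, ha]
        ring
      · refine ⟨⟨j.val + K - (k + 1).val, by omega⟩, ?_⟩
        rw [Nat.cast_sub (by omega), ha, Nat.cast_add, ZMod.natCast_self]
        ring
    obtain ⟨i, hi⟩ := hcast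
    change x (j.val : ZMod K) - x' (j.val : ZMod K) = 0
    rw [hi, hx i, sub_self]
  have hk : x (k.val : ZMod K) - x' (k.val : ZMod K) = 0 :=
    congrFun hzero ⟨k.val, ZMod.val_lt k⟩
  rwa [ZMod.natCast_zmod_val, sub_eq_zero] at hk
end

section
/- Let F be a field, let m ≤ n be positive integers, and let P be an m × n matrix over F such that (i) the leftmost m × m submatrix of P (columns 1,…,m) is the identity matrix I_m, and (ii) every m cyclically adjacent columns of P are linearly independent (for every k ∈ ℤ/nℤ, columns k, k+1, …, k+m−1 of P, indices modulo n, are linearly independent). Let L be the (m+n) × m matrix obtained by stacking I_m on top of the transpose P^T. Then every m cyclically adjacent rows of L are linearly independent: for every k ∈ ℤ/(m+n)ℤ, the rows of L with indices k, k+1, …, k+m−1 (taken modulo m+n) are linearly independent over F. -/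
/-- Duality: if `P` is an `m × n` matrix (`m ≤ n`) whose leftmost `m × m` block is the
identity and whose every `m` cyclically adjacent columns are linearly independent,
then in the `(m+n) × m` matrix `L = [I_m ; P.transpose]` every `m` cyclically adjacent rows
are linearly independent. -/
theorem identity_stack_transpose_adjacent_rows_linearIndependent
    (F : Type*) [Field F] (m n : ℕ) (hm : 0 < m) (hmn : m ≤ n)
    (P : Matrix (Fin m) (ZMod n) F)
    (hleft : ∀ i j : Fin m, P i ((j.val : ZMod n)) = if i = j then 1 else 0)
    (hcols : ∀ k : ZMod n,
      LinearIndependent F (fun s : Fin m => P.transpose (k + (s.val : ZMod n))))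
    (L : Matrix (ZMod (m + n)) (Fin m) F)
    (hL1 : ∀ (i : ZMod (m + n)) (j : Fin m), i.val < m →
      L i j = if i.val = j.val then 1 else 0)
    (hL2 : ∀ (i : ZMod (m + n)) (j : Fin m), m ≤ i.val →
      L i j = P j ((i.val - m : ℕ) : ZMod n)) :
    ∀ k : ZMod (m + n),
      LinearIndependent F (fun s : Fin m => L (k + (s.val : ZMod (m + n)))) := by
  intro k
  have : NeZero n := ⟨by omega⟩
  have : NeZero (m + n) := ⟨by omega⟩
  have row_lt : ∀ t : ℕ, t < m → L (t : ZMod (m + n)) = P.transpose (t : ZMod n) := by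
    intro t ht
    have hv : (t : ZMod (m + n)).val = t := ZMod.val_cast_of_lt (by omega)
    funext j
    rw [hL1 _ _ (by omega), hv, Matrix.transpose_apply, hleft j ⟨t, ht⟩]
    simp only [Fin.ext_iff, eq_comm]
  have row_ge : ∀ t : ℕ, m ≤ t → t < m + n →
      L (t : ZMod (m + n)) = P.transpose ((t - m : ℕ) : ZMod n) := by
    intro t ht htn
    have hv : (t : ZMod (m + n)).val = t := ZMod.val_cast_of_lt htn
    funext j
    rw [hL2 _ _ (by omega), hv, Matrix.transpose_apply]
  obtain ⟨K, hK, rfl⟩ : ∃ K : ℕ, K < m + n ∧ (K : ZMod (m + n)) = k :=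
    ⟨k.val, k.val_lt, ZMod.natCast_zmod_val k⟩
  simp only [← Nat.cast_add]
  rcases lt_or_ge K m with hKm | hKm
  · -- The window is a cyclic rotation of the standard basis.
    let f : Fin m → Fin m := fun s =>
      if h : K + s.val < m then ⟨K + s.val, h⟩ else ⟨K + s.val - m, by omega⟩
    have hf : Function.Injective f := by
      intro a b hab
      simp only [f] at hab
      split_ifs at hab <;> simp only [Fin.mk.injEq] at hab <;> ext <;> omega
    convert (hcols 0).comp f hf using 2 with s
    simp only [Function.comp_apply, zero_add, f]
    split_ifs with h
    · exact row_lt _ h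
    · exact row_ge _ (by omega) (by omega)
  · -- The window is the one of `P` starting at column `K - m`.
    convert hcols ((K - m : ℕ) : ZMod n) using 2 with s
    rw [← Nat.cast_add]
    rcases lt_or_ge (K + s.val) (m + n) with h | h
    · rw [row_ge _ (by omega) h, Nat.sub_add_comm hKm]
    · have hL : ((K + s.val : ℕ) : ZMod (m + n)) = ((K + s.val - (m + n) : ℕ) : ZMod (m + n)) := by
        rw [Nat.cast_sub h, ZMod.natCast_self, sub_zero]
      have hP : K - m + s.val = K + s.val - (m + n) + n := by omega
      rw [hL, row_lt _ (by omega), hP, Nat.cast_add _ n, ZMod.natCast_self, add_zero]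
end

section
/- Let F be a field and let K, D be positive integers with D ≤ K−1. Let L be a K × (K−D) matrix over F with rows indexed by ℤ/Kℤ such that every K−D cyclically adjacent rows of L are linearly independent. Then for every integer shift t with 0 ≤ t ≤ K−D−1, the matrix L is a valid encoding matrix for the symmetric consecutive (but not necessarily neighboring) side-information problem: for every k ∈ ℤ/Kℤ and all message vectors x, x' ∈ F^K, if x_i = x'_i for every i ∈ {k+t+1, k+t+2, …, k+t+D} (indices modulo K) and x·L = x'·L, then x_k = x'_k. -/
/-- A `K × (K-D)` matrix whose every `K - D` cyclically adjacent rows are linearly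
independent is a valid encoding matrix for the symmetric consecutive (shifted)
one-sided side-information problem, for every shift `t ∈ {0, …, K-D-1}`. -/
theorem adjacent_rows_linearIndependent_encodes_consecutive_sideInfo
    (F : Type*) [Field F] (K D : ℕ) [NeZero K] (hD : 1 ≤ D) (hDK : D ≤ K - 1)
    (L : Matrix (ZMod K) (Fin (K - D)) F)
    (hLI : ∀ k : ZMod K,
      LinearIndependent F (fun s : Fin (K - D) => L (k + (s.val : ZMod K)))) :
    ∀ t : ℕ, t ≤ K - D - 1 → ∀ k : ZMod K, ∀ x x' : ZMod K → F,
      (∀ i : Fin D,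
        x (k + (t : ZMod K) + 1 + (i.val : ZMod K)) =
          x' (k + (t : ZMod K) + 1 + (i.val : ZMod K))) →
      Matrix.vecMul x L = Matrix.vecMul x' L → x k = x' k := by
  intro t ht k x x' hx hxL
  have hDK' : D < K := by have := NeZero.pos K; omega
  set a : ZMod K := k + (t : ZMod K) + 1 with ha
  have hsum : ∑ s : Fin (K - D),
      (x (a + D + (s.val : ZMod K)) - x' (a + D + (s.val : ZMod K))) •
        L (a + D + (s.val : ZMod K)) = 0 := by
    have htotal : ∑ i : ZMod K, (x i - x' i) • L i = 0 := by
      have h : Matrix.vecMul (x - x') L = 0 := by rw [Matrix.sub_vecMul, hxL, sub_self]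
      exact (Matrix.vecMul_eq_sum (x - x') L).symm.trans h
    rw [← htotal]
    refine Fintype.sum_of_injective (fun s : Fin (K - D) => a + D + (s.val : ZMod K))
      ?_ _ _ ?_ fun _ => rfl
    · intro s s' h
      have hval := congrArg ZMod.val (add_left_cancel h)
      rw [ZMod.val_cast_of_lt (by omega), ZMod.val_cast_of_lt (by omega)] at hval
      exact Fin.ext hval
    · intro i hi
      have hlt := ZMod.val_lt (i - a)
      have hi_eq : a + ((i - a).val : ZMod K) = i := by simp
      by_cases hv : (i - a).val < D
      · have h := hx ⟨(i - a).val, hv⟩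
        simp only [hi_eq] at h
        rw [h, sub_self, zero_smul]
      · refine absurd ⟨⟨(i - a).val - D, by omega⟩, ?_⟩ hi
        change a + D + (((i - a).val - D : ℕ) : ZMod K) = i
        rw [add_assoc, ← Nat.cast_add, Nat.add_sub_cancel' (not_lt.mp hv), hi_eq]
  have hk : a + D + ((K - D - 1 - t : ℕ) : ZMod K) = k := by
    have h : ((t + 1 + D + (K - D - 1 - t) : ℕ) : ZMod K) = 0 := by
      rw [show t + 1 + D + (K - D - 1 - t) = K by omega, ZMod.natCast_self]
    push_cast at h
    rw [ha]
    linear_combination h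
  have hzero := Fintype.linearIndependent_iff.mp (hLI (a + D)) _ hsum
    ⟨K - D - 1 - t, by omega⟩
  simp only [hk] at hzero
  exact sub_eq_zero.mp hzero
end
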